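/- arXiv:2409.17552 — 3 statements merged into one kernel-verified Lean document; each statement's English description precedes it below -/
import Mathlib

section
/- (Lipschitz continuity of the data-to-solution map) For all a₁, a₂ ∈ D_{α,β}, ‖S(a₁) − S(a₂)‖_Y ≤ (‖f‖_{Y'}/(α−β)²) ‖a₁ − a₂‖_X; in particular S is Lipschitz continuous on D_{α,β} with a constant depending only on α, β and ‖f‖_{Y'}. -/
/-- Cancelling one factor `t` from a quadratic lower bound and a linear upper bound. -/
lemma mul_le_of_mul_sq_le_mul {c K t : ℝ} (hK : 0 ≤ K) (ht : 0 ≤ t)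
    (h : c * t ^ 2 ≤ K * t) : c * t ≤ K := by
  rcases ht.eq_or_lt with rfl | ht
  · simpa using hK
  · exact le_of_mul_le_mul_right (by linarith [show c * t * t = c * t ^ 2 by ring]) ht

/-- Lipschitz continuity of the data-to-solution map: for all `a₁, a₂ ∈ D_{α,β}`,
`‖S(a₁) − S(a₂)‖_Y ≤ (‖f‖_{Y'}/(α−β)²) ‖a₁ − a₂‖_X`. -/
theorem stmt1
    {X Y : Type*} [NormedAddCommGroup X] [NormedSpace ℝ X]
    [NormedAddCommGroup Y] [InnerProductSpace ℝ Y] [CompleteSpace Y]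
    (b : X →L[ℝ] Y →L[ℝ] Y →L[ℝ] ℝ)
    (hb : ∀ (a : X) (u v : Y), |b a u v| ≤ ‖a‖ * ‖u‖ * ‖v‖)
    (α β : ℝ) (hβ : 0 < β) (hβα : β < α)
    (f : Y →L[ℝ] ℝ) (hf : f ≠ 0)
    (D : Set X)
    (hD : D = {a : X | (∀ w : Y, (α - β) * ‖w‖ ^ 2 ≤ b a w w) ∧
      ∀ v w : Y, |b a v w| ≤ (α + β) * ‖v‖ * ‖w‖})
    (S : X → Y) (hS : ∀ a ∈ D, ∀ v : Y, b a (S a) v = f v)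
    (a₁ a₂ : X) (ha₁ : a₁ ∈ D) (ha₂ : a₂ ∈ D) :
    ‖S a₁ - S a₂‖ ≤ ‖f‖ / (α - β) ^ 2 * ‖a₁ - a₂‖ := by
  subst hD
  have hc : 0 < α - β := sub_pos.2 hβα
  have hbound : (α - β) * ‖S a₂‖ ≤ ‖f‖ := by
    refine mul_le_of_mul_sq_le_mul (norm_nonneg _) (norm_nonneg _) ?_
    calc (α - β) * ‖S a₂‖ ^ 2 ≤ b a₂ (S a₂) (S a₂) := ha₂.1 _
      _ = f (S a₂) := hS a₂ ha₂ _
      _ ≤ ‖f‖ * ‖S a₂‖ := (le_abs_self _).trans (f.le_opNorm _)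
  have hdiff : (α - β) * ‖S a₁ - S a₂‖ ≤ ‖a₁ - a₂‖ * ‖S a₂‖ := by
    refine mul_le_of_mul_sq_le_mul (by positivity) (norm_nonneg _) ?_
    calc (α - β) * ‖S a₁ - S a₂‖ ^ 2 ≤ b a₁ (S a₁ - S a₂) (S a₁ - S a₂) := ha₁.1 _
      _ = b (a₂ - a₁) (S a₂) (S a₁ - S a₂) := by
        have h₁ := hS a₁ ha₁ (S a₁ - S a₂)
        have h₂ := hS a₂ ha₂ (S a₁ - S a₂)
        simp only [map_sub (b a₁), map_sub b, sub_apply, h₁, h₂]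
      _ ≤ ‖a₂ - a₁‖ * ‖S a₂‖ * ‖S a₁ - S a₂‖ := (le_abs_self _).trans (hb _ _ _)
      _ = ‖a₁ - a₂‖ * ‖S a₂‖ * ‖S a₁ - S a₂‖ := by rw [norm_sub_rev]
  rw [div_mul_eq_mul_div, le_div_iff₀ (by positivity)]
  calc ‖S a₁ - S a₂‖ * (α - β) ^ 2 = (α - β) * ((α - β) * ‖S a₁ - S a₂‖) := by ring
    _ ≤ (α - β) * (‖a₁ - a₂‖ * ‖S a₂‖) := by gcongr
    _ = (α - β) * ‖S a₂‖ * ‖a₁ - a₂‖ := by ring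
    _ ≤ ‖f‖ * ‖a₁ - a₂‖ := by gcongr
end

section
/- (Lemma 5.3, unrolled Richardson iterator network) Let 0 < β < α < ∞. There exists C > 0 such that for all ε ∈ (0,1), all K ∈ ℕ, and all N ∈ ℕ there exists a ReLU neural network Φ with input dimension (N+1)² and output dimension N+1 such that for every matrix A ∈ ℝ^{(N+1)×(N+1)} with spectral norm ‖A‖₂ ≤ β/α, ‖R(Φ)(vec(A)) − c^{(K)}‖_{ℓ²} ≤ ε, where c^{(0)} := e₁ and c^{(k+1)} := A c^{(k)} + e₁ for k ≥ 0, and moreover depth(Φ) ≤ C K(|log ε| + log N + 1) and size(Φ) ≤ C K N²(|log ε| + log N + 1). -/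
open scoped Classical

/-- Euclidean (ℓ²) norm of a vector in `ℝ^n`. -/
noncomputable def l2norm {n : ℕ} (x : Fin n → ℝ) : ℝ := Real.sqrt (∑ i, x i ^ 2)

/-- Column-stacking (vectorization) of a square matrix. -/
def vecMat {n : ℕ} (A : Matrix (Fin n) (Fin n) ℝ) : Fin (n * n) → ℝ :=
  fun i => A (finProdFinEquiv.symm i).1 (finProdFinEquiv.symm i).2

/-- The ReLU activation function. -/
noncomputable def relu (x : ℝ) : ℝ := max x 0

/-- A feedforward neural network with input dimension `n` and output dimension `m`:
a finite list of affine (matrix, bias) layers. -/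
inductive NN : ℕ → ℕ → Type
  | last : {n m : ℕ} → Matrix (Fin m) (Fin n) ℝ → (Fin m → ℝ) → NN n m
  | cons : {n k m : ℕ} → Matrix (Fin k) (Fin n) ℝ → (Fin k → ℝ) → NN k m → NN n m

namespace NN

/-- Depth (number of affine layers) of a network. -/
def depth : ∀ {n m : ℕ}, NN n m → ℕ
  | _, _, last _ _ => 1
  | _, _, cons _ _ Φ => Φ.depth + 1

/-- Number of nonzero entries of a matrix. -/
noncomputable def matSize {m n : ℕ} (A : Matrix (Fin m) (Fin n) ℝ) : ℕ :=
  (Finset.univ.filter fun p : Fin m × Fin n => A p.1 p.2 ≠ 0).card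

/-- Number of nonzero entries of a vector. -/
noncomputable def vecSize {m : ℕ} (c : Fin m → ℝ) : ℕ :=
  (Finset.univ.filter fun i => c i ≠ 0).card

/-- Size: total number of nonzero weights and biases. -/
noncomputable def size : ∀ {n m : ℕ}, NN n m → ℕ
  | _, _, last A c => matSize A + vecSize c
  | _, _, cons A c Φ => matSize A + vecSize c + Φ.size

/-- Realization of a network with ReLU activation. -/
noncomputable def realize : ∀ {n m : ℕ}, NN n m → (Fin n → ℝ) → Fin m → ℝ
  | _, _, last A c, x => A.mulVec x + c
  | _, _, cons A c Φ, x => Φ.realize fun i => relu (A.mulVec x i + c i)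

end NN

/-- The affine iteration `c⁽⁰⁾ = e₁`, `c⁽ᵏ⁺¹⁾ = A c⁽ᵏ⁾ + e₁`. -/
noncomputable def iterC {n : ℕ} (A : Matrix (Fin n) (Fin n) ℝ) : ℕ → Fin n → ℝ
  | 0 => fun i : Fin n => if (i : ℕ) = 0 then (1 : ℝ) else 0
  | k + 1 => A.mulVec (iterC A k) + fun i : Fin n => if (i : ℕ) = 0 then (1 : ℝ) else 0

lemma relu_sub_relu_neg (x : ℝ) : relu x - relu (-x) = x := by
  unfold relu
  rcases le_total 0 x with h | h
  · rw [max_eq_left h, max_eq_right (by linarith)]; ring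
  · rw [max_eq_right h, max_eq_left (by linarith)]; ring

lemma relu_add_relu_neg (x : ℝ) : relu x + relu (-x) = |x| := by
  unfold relu
  rcases le_total 0 x with h | h
  · rw [max_eq_left h, max_eq_right (by linarith), abs_of_nonneg h]; ring
  · rw [max_eq_right h, max_eq_left (by linarith), abs_of_nonpos h]; ring

/-- `f` is an affine map given by a matrix and a bias with at most `s` nonzero entries in total. -/
def SparseAffine {ι κ : Type} [Fintype ι] [Fintype κ] (f : (ι → ℝ) → κ → ℝ) (s : ℕ) : Prop :=
  ∃ (P : Matrix κ ι ℝ) (b : κ → ℝ), (∀ x, f x = P.mulVec x + b) ∧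
    (Finset.univ.filter fun p : κ × ι => P p.1 p.2 ≠ 0).card +
      (Finset.univ.filter fun i => b i ≠ 0).card ≤ s

namespace SparseAffine

variable {ι κ : Type} [Fintype ι] [Fintype κ]

lemma mono {f : (ι → ℝ) → κ → ℝ} {s t : ℕ} (hf : SparseAffine f s) (h : s ≤ t) :
    SparseAffine f t := by
  obtain ⟨P, b, hP, hs⟩ := hf
  exact ⟨P, b, hP, hs.trans h⟩

lemma add {f g : (ι → ℝ) → κ → ℝ} {s t : ℕ} (hf : SparseAffine f s) (hg : SparseAffine g t) :
    SparseAffine (fun x i => f x i + g x i) (s + t) := by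
  obtain ⟨P, b, hP, hs⟩ := hf
  obtain ⟨Q, c, hQ, ht⟩ := hg
  refine ⟨P + Q, b + c, fun x => ?_, ?_⟩
  · funext i
    simp only [hP, hQ, Matrix.add_mulVec, Pi.add_apply]
    ring
  · have h₁ : (Finset.univ.filter fun p : κ × ι => (P + Q) p.1 p.2 ≠ 0) ⊆
        (Finset.univ.filter fun p : κ × ι => P p.1 p.2 ≠ 0) ∪
          (Finset.univ.filter fun p : κ × ι => Q p.1 p.2 ≠ 0) := by
      intro p hp
      have hp' : P p.1 p.2 + Q p.1 p.2 ≠ 0 := (Finset.mem_filter.1 hp).2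
      simp only [Finset.mem_union, Finset.mem_filter, Finset.mem_univ, true_and]
      by_contra! h
      exact hp' (by rw [h.1, h.2, add_zero])
    have h₂ : (Finset.univ.filter fun i => (b + c) i ≠ 0) ⊆
        (Finset.univ.filter fun i => b i ≠ 0) ∪ (Finset.univ.filter fun i => c i ≠ 0) := by
      intro p hp
      simp only [Finset.mem_union, Finset.mem_filter, Finset.mem_univ, true_and,
        Pi.add_apply] at hp ⊢
      by_contra! h
      exact hp (by rw [h.1, h.2, add_zero])
    have h₃ := (Finset.card_le_card h₁).trans (Finset.card_union_le _ _)
    have h₄ := (Finset.card_le_card h₂).trans (Finset.card_union_le _ _)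
    omega

lemma const (b : κ → ℝ) : SparseAffine (fun (_ : ι → ℝ) => b) (Fintype.card κ) := by
  refine ⟨0, b, fun x => by simp, ?_⟩
  simpa using Finset.card_le_univ _

/-- An affine map described by weighted edges. -/
lemma edges [DecidableEq κ] {E : Type} [Fintype E] (src : E → ι) (dst : E → κ) (w : E → ℝ) :
    SparseAffine (fun x i => ∑ e, if dst e = i then w e * x (src e) else 0) (Fintype.card E) := by
  refine ⟨fun i j => ∑ e, if dst e = i ∧ src e = j then w e else 0, 0, fun x => ?_, ?_⟩
  · funext i
    simp only [Matrix.mulVec, dotProduct, add_zero, Finset.sum_mul]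
    rw [Finset.sum_comm]
    refine Finset.sum_congr rfl fun e _ => ?_
    by_cases h : dst e = i <;> simp [h]
  · have h₁ : (Finset.univ.filter fun p : κ × ι =>
        (∑ e, if dst e = p.1 ∧ src e = p.2 then w e else 0) ≠ 0) ⊆
        Finset.univ.image fun e => (dst e, src e) := by
      intro p hp
      simp only [Finset.mem_filter, Finset.mem_univ, true_and, Finset.mem_image] at hp ⊢
      obtain ⟨e, -, he⟩ := Finset.exists_ne_zero_of_sum_ne_zero hp
      refine ⟨e, ?_⟩
      by_contra h
      exact he (if_neg fun h' => h (Prod.ext h'.1 h'.2))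
    have h₂ := (Finset.card_le_card h₁).trans Finset.card_image_le
    simpa using h₂

/-- An affine map each of whose outputs is a multiple of a single input. -/
lemma gather (src : κ → ι) (w : κ → ℝ) :
    SparseAffine (fun x i => w i * x (src i)) (Fintype.card κ) := by
  simpa using edges src id w

/-- Both signs of each output. -/
lemma signs {f : (ι → ℝ) → κ → ℝ} {s : ℕ} (hf : SparseAffine f s) :
    SparseAffine (fun x (q : κ × Bool) => if q.2 then f x q.1 else -f x q.1) (2 * s) := by
  obtain ⟨P, b, hP, hs⟩ := hf
  refine ⟨fun q j => if q.2 then P q.1 j else -P q.1 j, fun q => if q.2 then b q.1 else -b q.1,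
    fun x => ?_, ?_⟩
  · funext ⟨i, t⟩
    cases t
    · simp [hP, Matrix.mulVec, dotProduct]
      ring
    · simp [hP, Matrix.mulVec, dotProduct]
  · have h₁ : (Finset.univ.filter fun p : (κ × Bool) × ι =>
        (if p.1.2 then P p.1.1 p.2 else -P p.1.1 p.2) ≠ 0) ⊆
        ((Finset.univ.filter fun p : κ × ι => P p.1 p.2 ≠ 0) ×ˢ (Finset.univ : Finset Bool)).image
          fun r => ((r.1.1, r.2), r.1.2) := by
      rintro ⟨⟨i, t⟩, j⟩ hp
      cases t <;> simpa using hp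
    have h₂ : (Finset.univ.filter fun q : κ × Bool => (if q.2 then b q.1 else -b q.1) ≠ 0) ⊆
        (Finset.univ.filter fun i => b i ≠ 0) ×ˢ (Finset.univ : Finset Bool) := by
      rintro ⟨i, t⟩ hp
      cases t <;> simpa using hp
    have h₃ := (Finset.card_le_card h₁).trans Finset.card_image_le
    have h₄ := Finset.card_le_card h₂
    simp only [Finset.card_product, Finset.card_univ, Fintype.card_bool] at h₃ h₄
    calc _ ≤ _ := Nat.add_le_add h₃ h₄
      _ ≤ 2 * s := by omega

/-- Transport along enumerations of the index types, in the form of a network layer. -/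
lemma exists_fin {f : (ι → ℝ) → κ → ℝ} {s : ℕ} (hf : SparseAffine f s) {n k : ℕ}
    (e : ι ≃ Fin n) (e' : κ ≃ Fin k) :
    ∃ (A : Matrix (Fin k) (Fin n) ℝ) (c : Fin k → ℝ),
      (∀ x q, A.mulVec (x ∘ e.symm) q + c q = f x (e'.symm q)) ∧
        NN.matSize A + NN.vecSize c ≤ s := by
  obtain ⟨P, b, hP, hs⟩ := hf
  refine ⟨fun q r => P (e'.symm q) (e.symm r), fun q => b (e'.symm q), fun x q => ?_, ?_⟩
  · rw [hP]
    simp only [Matrix.mulVec, dotProduct, Pi.add_apply, Function.comp_apply]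
    rw [Equiv.sum_comp e.symm fun j => P (e'.symm q) j * x j]
  · refine le_trans (Nat.add_le_add ?_ ?_) hs
    · exact Finset.card_le_card_of_injOn (fun p => (e'.symm p.1, e.symm p.2))
        (fun p hp => by simpa using hp) (fun p _ q _ h => by simpa [Prod.ext_iff] using h)
    · exact Finset.card_le_card_of_injOn (fun p => e'.symm p)
        (fun p hp => by simpa using hp) (fun p _ q _ h => by simpa using h)

end SparseAffine

/-- The positive and negative parts of a vector. -/
noncomputable def posNeg {σ : Type} (v : σ → ℝ) : σ × Bool → ℝ :=
  fun q => relu (if q.2 then v q.1 else -v q.1)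

/-- `T v` depends affinely and sparsely on the positive and negative parts of `v`. -/
def SparseLayer {σ τ : Type} [Fintype σ] [Fintype τ] (T : (σ → ℝ) → τ → ℝ) (s : ℕ) : Prop :=
  ∃ f : (σ × Bool → ℝ) → τ → ℝ, SparseAffine f s ∧ ∀ v, f (posNeg v) = T v

namespace SparseLayer

variable {σ τ : Type} [Fintype σ] [Fintype τ]

lemma mono {T : (σ → ℝ) → τ → ℝ} {s t : ℕ} (hT : SparseLayer T s) (h : s ≤ t) :
    SparseLayer T t := by
  obtain ⟨f, hf, hf'⟩ := hT
  exact ⟨f, hf.mono h, hf'⟩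

lemma add {S T : (σ → ℝ) → τ → ℝ} {s t : ℕ} (hS : SparseLayer S s) (hT : SparseLayer T t) :
    SparseLayer (fun v i => S v i + T v i) (s + t) := by
  obtain ⟨f, hf, hf'⟩ := hS
  obtain ⟨g, hg, hg'⟩ := hT
  exact ⟨_, hf.add hg, fun v => by simp only [hf', hg']⟩

lemma const (b : τ → ℝ) : SparseLayer (fun (_ : σ → ℝ) => b) (Fintype.card τ) :=
  ⟨_, SparseAffine.const b, fun _ => rfl⟩

lemma edges [DecidableEq τ] {E : Type} [Fintype E] (src : E → σ) (dst : E → τ) (w : E → ℝ) :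
    SparseLayer (fun v i => ∑ e, if dst e = i then w e * v (src e) else 0)
      (Fintype.card E + Fintype.card E) := by
  refine ⟨_, (SparseAffine.edges (fun e => (src e, true)) dst w).add
    (SparseAffine.edges (fun e => (src e, false)) dst fun e => -w e), fun v => ?_⟩
  funext i
  rw [← Finset.sum_add_distrib]
  refine Finset.sum_congr rfl fun e _ => ?_
  split_ifs
  · simp only [posNeg, if_true, Bool.false_eq_true, if_false]
    linear_combination w e * relu_sub_relu_neg (v (src e))
  · ring

lemma gather (src : τ → σ) (w : τ → ℝ) :
    SparseLayer (fun v i => w i * v (src i)) (Fintype.card τ + Fintype.card τ) := by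
  simpa using edges src id w

lemma gather_abs (src : τ → σ) (w : τ → ℝ) :
    SparseLayer (fun v i => w i * |v (src i)|) (Fintype.card τ + Fintype.card τ) := by
  refine ⟨_, (SparseAffine.gather (fun i => (src i, true)) w).add
    (SparseAffine.gather (fun i => (src i, false)) w), fun v => ?_⟩
  funext i
  simp only [posNeg, if_true, Bool.false_eq_true, if_false]
  linear_combination w i * relu_add_relu_neg (v (src i))

end SparseLayer

/-- `F v` is computed from the positive and negative parts of `v` by a network of depth `d` and
size at most `s`. -/
def Computes {σ : Type} [Fintype σ] {m : ℕ} (F : (σ → ℝ) → Fin m → ℝ) (d s : ℕ) : Prop :=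
  ∃ (k : ℕ) (e : σ × Bool ≃ Fin k) (Φ : NN k m),
    (∀ v, Φ.realize (posNeg v ∘ e.symm) = F v) ∧ Φ.depth = d ∧ Φ.size ≤ s

namespace Computes

variable {σ τ : Type} [Fintype σ] [Fintype τ] {m : ℕ}

lemma of_sparseLayer {T : (σ → ℝ) → Fin m → ℝ} {t : ℕ} (hT : SparseLayer T t) :
    Computes T 1 t := by
  obtain ⟨f, hf, hf'⟩ := hT
  obtain ⟨A, c, hA, hs⟩ := hf.exists_fin (Fintype.equivFin _) (Equiv.refl _)
  refine ⟨_, Fintype.equivFin _, NN.last A c, fun v => ?_, rfl, hs⟩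
  funext i
  rw [← hf']
  exact hA _ _

lemma exists_network {F : (τ → ℝ) → Fin m → ℝ} {d s t n : ℕ} (hF : Computes F d s)
    {f : (Fin n → ℝ) → τ → ℝ} (hf : SparseAffine f t) :
    ∃ Φ : NN n m, (∀ x, Φ.realize x = F (f x)) ∧ Φ.depth = d + 1 ∧ Φ.size ≤ s + 2 * t := by
  obtain ⟨k, e, Φ, hΦ, hd, hs⟩ := hF
  obtain ⟨A, c, hA, hs'⟩ := hf.signs.exists_fin (Equiv.refl _) e
  refine ⟨NN.cons A c Φ, fun x => ?_, by rw [NN.depth, hd], by rw [NN.size]; omega⟩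
  rw [NN.realize, ← hΦ]
  congr 1
  funext q
  exact congrArg relu (hA x q)

lemma comp {F : (τ → ℝ) → Fin m → ℝ} {d s t : ℕ} (hF : Computes F d s)
    {T : (σ → ℝ) → τ → ℝ} (hT : SparseLayer T t) :
    Computes (F ∘ T) (d + 1) (s + 2 * t) := by
  obtain ⟨k, e, Φ, hΦ, hd, hs⟩ := hF
  obtain ⟨f, hf, hf'⟩ := hT
  obtain ⟨A, c, hA, hs'⟩ := hf.signs.exists_fin (Fintype.equivFin _) e
  refine ⟨_, Fintype.equivFin _, NN.cons A c Φ, fun v => ?_, by rw [NN.depth, hd],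
    by rw [NN.size]; omega⟩
  rw [NN.realize, Function.comp_apply, ← hΦ, ← hf']
  congr 1
  funext q
  exact congrArg relu (hA _ q)

lemma iterate {G : (σ → ℝ) → σ → ℝ} {a b : ℕ}
    (hG : ∀ (F : (σ → ℝ) → Fin m → ℝ) (d s : ℕ), Computes F d s →
      Computes (F ∘ G) (d + a) (s + b))
    {F : (σ → ℝ) → Fin m → ℝ} {d s : ℕ} (hF : Computes F d s) (k : ℕ) :
    Computes (F ∘ G^[k]) (d + k * a) (s + k * b) := by
  induction k with
  | zero => simpa using hF
  | succ k ih =>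
    have h := hG _ _ _ ih
    rw [Function.comp_assoc, ← Function.iterate_succ] at h
    convert h using 1 <;> ring

end Computes

lemma l2norm_eq_norm {n : ℕ} (x : Fin n → ℝ) : l2norm x = ‖WithLp.toLp 2 x‖ := by
  simp [l2norm, EuclideanSpace.norm_eq]

lemma l2norm_add_le {n : ℕ} (x y : Fin n → ℝ) : l2norm (x + y) ≤ l2norm x + l2norm y := by
  simpa only [l2norm_eq_norm, WithLp.toLp_add] using norm_add_le _ _

lemma l2norm_smul {n : ℕ} (r : ℝ) (x : Fin n → ℝ) : l2norm (r • x) = |r| * l2norm x := by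
  rw [l2norm_eq_norm, l2norm_eq_norm, WithLp.toLp_smul, norm_smul, Real.norm_eq_abs]

lemma abs_le_l2norm {n : ℕ} (x : Fin n → ℝ) (i : Fin n) : |x i| ≤ l2norm x := by
  rw [← Real.sqrt_sq_eq_abs]
  exact Real.sqrt_le_sqrt
    (Finset.single_le_sum (f := fun i => x i ^ 2) (fun j _ => sq_nonneg _) (Finset.mem_univ i))

lemma l2norm_single {n : ℕ} (i : Fin n) : l2norm (Pi.single i 1) = 1 := by
  simp [l2norm, Pi.single_apply]

lemma l2norm_le_mul {n : ℕ} {x : Fin n → ℝ} {t : ℝ} (h : ∀ i, |x i| ≤ t) :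
    l2norm x ≤ n * t := by
  rcases Nat.eq_zero_or_pos n with rfl | hn
  · simp [l2norm]
  have ht : 0 ≤ t := (abs_nonneg _).trans (h ⟨0, hn⟩)
  refine Real.sqrt_le_iff.2 ⟨by positivity, ?_⟩
  calc ∑ i, x i ^ 2 ≤ ∑ _i : Fin n, t ^ 2 :=
        Finset.sum_le_sum fun i _ => sq_le_sq.2 (by rw [abs_of_nonneg ht]; exact h i)
    _ = n * t ^ 2 := by simp
    _ ≤ n * (n * t ^ 2) := by
        have : (1 : ℝ) ≤ n := by exact_mod_cast hn
        have h₂ : 0 ≤ t ^ 2 := sq_nonneg t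
        exact mul_le_mul_of_nonneg_left (le_mul_of_one_le_left h₂ this) (by positivity)
    _ = (n * t) ^ 2 := by ring

lemma abs_entry_le {n : ℕ} {A : Matrix (Fin n) (Fin n) ℝ} {r : ℝ}
    (hA : ∀ x, l2norm (A.mulVec x) ≤ r * l2norm x) (i j : Fin n) : |A i j| ≤ r := by
  have h := (abs_le_l2norm _ i).trans (hA (Pi.single j 1))
  simpa [l2norm_single] using h

/-- Indices of the state of the network: for each matrix entry, the entry itself, two folded
arguments, and an accumulator. -/
abbrev StateIdx (n : ℕ) : Type := (Fin n × Fin n) × Fin 4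

/-- One folding step: both arguments `u` are replaced by `1 - 2 * |u|`, and the difference of
their absolute values is accumulated. -/
noncomputable def foldStep (n : ℕ) (v : StateIdx n → ℝ) (t : StateIdx n) : ℝ :=
  (![1, 0, 0, 4] : Fin 4 → ℝ) t.2 * v t + (![0, -2, -2, 0] : Fin 4 → ℝ) t.2 * |v t| +
    (![0, 0, 0, 1] : Fin 4 → ℝ) t.2 * |v (t.1, 1)| +
    (![0, 0, 0, -1] : Fin 4 → ℝ) t.2 * |v (t.1, 2)| + (![0, 1, 1, 0] : Fin 4 → ℝ) t.2

/-- Prepare the multiplication of the entry `(i, j)` with the `j`-th diagonal accumulator. -/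
noncomputable def prepareStep (n : ℕ) (v : StateIdx n → ℝ) (t : StateIdx n) : ℝ :=
  (![1, 1 / 2, 1 / 2, 0] : Fin 4 → ℝ) t.2 * v (t.1, 0) +
    (![0, 1 / 2, -1 / 2, 0] : Fin 4 → ℝ) t.2 * v ((t.1.2, t.1.2), 3)

/-- Sum the accumulators of each row, weighted by `r`, into the diagonal accumulators, and add the
vector `b`. -/
noncomputable def collectStep (n : ℕ) (r : ℝ) (b : Fin n → ℝ) (v : StateIdx n → ℝ)
    (t : StateIdx n) : ℝ :=
  (![1, 0, 0, 0] : Fin 4 → ℝ) t.2 * v (t.1, 0) +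
    (∑ e : Fin n × Fin n, if ((e.1, e.1), (3 : Fin 4)) = t then r * v (e, 3) else 0) +
    (![0, 0, 0, 1] : Fin 4 → ℝ) t.2 * b t.1.1

lemma sparseLayer_foldStep (n : ℕ) : SparseLayer (foldStep n) (36 * (n * n)) := by
  have h := ((((SparseLayer.gather (fun t : StateIdx n => t)
    fun t => (![1, 0, 0, 4] : Fin 4 → ℝ) t.2).add
    (SparseLayer.gather_abs (fun t : StateIdx n => t)
      fun t => (![0, -2, -2, 0] : Fin 4 → ℝ) t.2)).add
    (SparseLayer.gather_abs (fun t : StateIdx n => (t.1, 1))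
      fun t => (![0, 0, 0, 1] : Fin 4 → ℝ) t.2)).add
    (SparseLayer.gather_abs (fun t : StateIdx n => (t.1, 2))
      fun t => (![0, 0, 0, -1] : Fin 4 → ℝ) t.2)).add
    (SparseLayer.const fun t : StateIdx n => (![0, 1, 1, 0] : Fin 4 → ℝ) t.2)
  refine h.mono (le_of_eq ?_)
  simp only [Fintype.card_prod, Fintype.card_fin]
  ring

lemma sparseLayer_prepareStep (n : ℕ) : SparseLayer (prepareStep n) (16 * (n * n)) := by
  have h := (SparseLayer.gather (fun t : StateIdx n => (t.1, 0))
    fun t => (![1, 1 / 2, 1 / 2, 0] : Fin 4 → ℝ) t.2).add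
    (SparseLayer.gather (fun t : StateIdx n => ((t.1.2, t.1.2), (3 : Fin 4)))
      fun t => (![0, 1 / 2, -1 / 2, 0] : Fin 4 → ℝ) t.2)
  refine h.mono (le_of_eq ?_)
  simp only [Fintype.card_prod, Fintype.card_fin]
  ring

lemma sparseLayer_collectStep (n : ℕ) (r : ℝ) (b : Fin n → ℝ) :
    SparseLayer (collectStep n r b) (14 * (n * n)) := by
  have h := ((SparseLayer.gather (fun t : StateIdx n => (t.1, 0))
    fun t => (![1, 0, 0, 0] : Fin 4 → ℝ) t.2).add
    (SparseLayer.edges (fun e : Fin n × Fin n => (e, (3 : Fin 4)))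
      (fun e => (((e.1, e.1), 3) : StateIdx n)) fun _ => r)).add
    (SparseLayer.const fun t : StateIdx n => (![0, 0, 0, 1] : Fin 4 → ℝ) t.2 * b t.1.1)
  refine h.mono (le_of_eq ?_)
  simp only [Fintype.card_prod, Fintype.card_fin]
  ring

lemma abs_one_sub_two_mul_abs_le {x : ℝ} (h : |x| ≤ 1) : |1 - 2 * abs x| ≤ 1 := by
  have := abs_nonneg x
  exact abs_le.2 ⟨by linarith, by linarith⟩

lemma foldStep_iterate {n : ℕ} (m : ℕ) (v : StateIdx n → ℝ) (x : Fin n × Fin n)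
    (h₁ : |v (x, 1)| ≤ 1) (h₂ : |v (x, 2)| ≤ 1) :
    (foldStep n)^[m] v (x, 0) = v (x, 0) ∧ |(foldStep n)^[m] v (x, 1)| ≤ 1 ∧
      |(foldStep n)^[m] v (x, 2)| ≤ 1 ∧
      (foldStep n)^[m] v (x, 1) ^ 2 - (foldStep n)^[m] v (x, 2) ^ 2 +
        4 * (foldStep n)^[m] v (x, 3) =
      4 ^ m * (v (x, 1) ^ 2 - v (x, 2) ^ 2 + 4 * v (x, 3)) := by
  induction m with
  | zero => simp [h₁, h₂]
  | succ m ih =>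
    rw [Function.iterate_succ_apply']
    set u := (foldStep n)^[m] v
    obtain ⟨i₀, i₁, i₂, i₃⟩ := ih
    have e₀ : foldStep n u (x, 0) = u (x, 0) := by simp [foldStep]
    have e₁ : foldStep n u (x, 1) = 1 - 2 * |u (x, 1)| := by simp [foldStep]; ring
    have e₂ : foldStep n u (x, 2) = 1 - 2 * |u (x, 2)| := by simp [foldStep]; ring
    have e₃ : foldStep n u (x, 3) = 4 * u (x, 3) + |u (x, 1)| - |u (x, 2)| := by
      simp [foldStep]; ring
    rw [e₀, e₁, e₂, e₃]
    refine ⟨i₀, abs_one_sub_two_mul_abs_le i₁, abs_one_sub_two_mul_abs_le i₂, ?_⟩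
    rw [pow_succ]
    linear_combination 4 * i₃ + 4 * sq_abs (u (x, 1)) - 4 * sq_abs (u (x, 2))

/-- One approximate affine iteration step on the state of the network. -/
noncomputable def iterStep (n m : ℕ) (b : Fin n → ℝ) (v : StateIdx n → ℝ) : StateIdx n → ℝ :=
  collectStep n (4 / 4 ^ m) b ((foldStep n)^[m] (prepareStep n v))

lemma collectStep_diag {n : ℕ} (r : ℝ) (b : Fin n → ℝ) (v : StateIdx n → ℝ) (i : Fin n) :
    collectStep n r b v ((i, i), 3) = ∑ j, r * v ((i, j), 3) + b i := by
  simp only [collectStep, Fintype.sum_prod_type]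
  rw [Finset.sum_comm]
  simp

lemma iterStep_spec {n : ℕ} (m : ℕ) (b : Fin n → ℝ) {A : Matrix (Fin n) (Fin n) ℝ} {y : Fin n → ℝ}
    {v : StateIdx n → ℝ} (hA : ∀ i j, |A i j| ≤ 1) (hy : ∀ j, |y j| ≤ 1)
    (hvA : ∀ i j, v ((i, j), 0) = A i j) (hvy : ∀ j, v ((j, j), 3) = y j) :
    (∀ i j, iterStep n m b v ((i, j), 0) = A i j) ∧
      ∀ i, |iterStep n m b v ((i, i), 3) - (A.mulVec y + b) i| ≤ n * (1 / 4 ^ m) := by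
  set u := (foldStep n)^[m] (prepareStep n v) with hu
  have key : ∀ i j, u ((i, j), 0) = A i j ∧
      |4 / 4 ^ m * u ((i, j), 3) - A i j * y j| ≤ 1 / 4 ^ m := by
    intro i j
    have p₀ : prepareStep n v ((i, j), 0) = A i j := by simp [prepareStep, hvA]
    have p₁ : prepareStep n v ((i, j), 1) = (A i j + y j) / 2 := by
      simp [prepareStep, hvA, hvy]; ring
    have p₂ : prepareStep n v ((i, j), 2) = (A i j - y j) / 2 := by
      simp [prepareStep, hvA, hvy]; ring
    have p₃ : prepareStep n v ((i, j), 3) = 0 := by simp [prepareStep]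
    have ha := abs_le.1 (hA i j)
    have hc := abs_le.1 (hy j)
    obtain ⟨h₀, h₁, h₂, h₃⟩ := foldStep_iterate m (prepareStep n v) (i, j)
      (by rw [p₁]; exact abs_le.2 ⟨by linarith, by linarith⟩)
      (by rw [p₂]; exact abs_le.2 ⟨by linarith, by linarith⟩)
    rw [← hu] at h₀ h₁ h₂ h₃
    refine ⟨h₀.trans p₀, ?_⟩
    rw [p₁, p₂, p₃] at h₃
    have h4 : (0 : ℝ) < 4 ^ m := by positivity
    have e : 4 / 4 ^ m * u ((i, j), 3) - A i j * y j =
        (u ((i, j), 2) ^ 2 - u ((i, j), 1) ^ 2) / 4 ^ m := by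
      field_simp
      linear_combination h₃
    rw [e, abs_div, abs_of_pos h4]
    refine div_le_div_of_nonneg_right ?_ h4.le
    have s₁ := (sq_le_one_iff_abs_le_one _).2 h₁
    have s₂ := (sq_le_one_iff_abs_le_one _).2 h₂
    have t₁ := sq_nonneg (u ((i, j), 1))
    have t₂ := sq_nonneg (u ((i, j), 2))
    exact abs_le.2 ⟨by linarith, by linarith⟩
  refine ⟨fun i j => ?_, fun i => ?_⟩
  · rw [← (key i j).1, iterStep, ← hu]
    simp [collectStep]
  · rw [iterStep, ← hu, collectStep_diag, Pi.add_apply, add_sub_add_right_eq_sub, Matrix.mulVec,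
      dotProduct, ← Finset.sum_sub_distrib]
    refine (Finset.abs_sum_le_sum_abs _ _).trans ?_
    refine (Finset.sum_le_sum fun j _ => (key i j).2).trans ?_
    simp

lemma iterStep_iterate {n m : ℕ} {δ R ε : ℝ} (hδ₀ : 0 ≤ δ) (hδ₁ : δ < 1) (hε₀ : 0 < ε)
    (hε₁ : ε ≤ 1) (hR : R * (1 - δ) = 2)
    (hm : R * (n * (n * (1 / 4 ^ m))) ≤ ε * (1 - δ))
    {A : Matrix (Fin n) (Fin n) ℝ} (hA : ∀ x, l2norm (A.mulVec x) ≤ δ * l2norm x)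
    {e : Fin n → ℝ} (he : l2norm e ≤ 1) {c : ℕ → Fin n → ℝ} (hc₀ : c 0 = e)
    (hc : ∀ k, c (k + 1) = A.mulVec (c k) + e) {v : StateIdx n → ℝ}
    (hvA : ∀ i j, v ((i, j), 0) = A i j) (hve : ∀ j, v ((j, j), 3) = R⁻¹ * e j) (k : ℕ) :
    (∀ i j, (iterStep n m (R⁻¹ • e))^[k] v ((i, j), 0) = A i j) ∧
      l2norm (fun i => (iterStep n m (R⁻¹ • e))^[k] v ((i, i), 3)) ≤ 1 ∧
      l2norm ((R • fun i => (iterStep n m (R⁻¹ • e))^[k] v ((i, i), 3)) - c k) ≤ ε := by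
  have hRpos : 0 < R := by
    by_contra h
    nlinarith
  have hRinv : R⁻¹ = (1 - δ) / 2 := by
    field_simp
    linarith
  induction k with
  | zero =>
    refine ⟨hvA, ?_, ?_⟩
    · have h : (fun i => v ((i, i), 3)) = R⁻¹ • e := by
        funext i
        exact hve i
      rw [Function.iterate_zero, id_eq, h, l2norm_smul, abs_of_pos (inv_pos.2 hRpos), hRinv]
      nlinarith
    · have h : (R • fun i => v ((i, i), 3)) - e = (0 : ℝ) • e := by
        funext i
        simp [hve, hRpos.ne']
      rw [Function.iterate_zero, id_eq, hc₀, h, l2norm_smul, abs_zero, zero_mul]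
      exact hε₀.le
  | succ k ih =>
    rw [Function.iterate_succ_apply']
    set u := (iterStep n m (R⁻¹ • e))^[k] v
    set y : Fin n → ℝ := fun i => u ((i, i), 3) with hy
    obtain ⟨i₀, i₁, i₂⟩ := ih
    obtain ⟨s₀, s₁⟩ := iterStep_spec m (R⁻¹ • e)
      (fun i j => (abs_entry_le hA i j).trans hδ₁.le)
      (fun j => (abs_le_l2norm y j).trans i₁) i₀ (fun _ => rfl)
    set z : Fin n → ℝ := fun i => iterStep n m (R⁻¹ • e) u ((i, i), 3) with hz
    have hd : l2norm (z - (A.mulVec y + R⁻¹ • e)) ≤ n * (n * (1 / 4 ^ m)) := l2norm_le_mul s₁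
    refine ⟨s₀, ?_, ?_⟩
    · have h₁ := l2norm_add_le (z - (A.mulVec y + R⁻¹ • e)) (A.mulVec y + R⁻¹ • e)
      rw [sub_add_cancel] at h₁
      have h₂ := l2norm_add_le (A.mulVec y) (R⁻¹ • e)
      rw [l2norm_smul, abs_of_pos (inv_pos.2 hRpos)] at h₂
      have h₃ := hA y
      have h₄ : (n : ℝ) * (n * (1 / 4 ^ m)) ≤ R⁻¹ := by
        rw [← mul_le_mul_iff_right₀ hRpos, mul_inv_cancel₀ hRpos.ne']
        nlinarith
      have h₅ : R⁻¹ * l2norm e ≤ R⁻¹ := mul_le_of_le_one_right (inv_pos.2 hRpos).le he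
      nlinarith
    · have h : R • z - c (k + 1) =
          R • (z - (A.mulVec y + R⁻¹ • e)) + A.mulVec (R • y - c k) := by
        rw [hc, Matrix.mulVec_sub, Matrix.mulVec_smul, smul_sub, smul_add,
          smul_inv_smul₀ hRpos.ne']
        abel
      have h₁ := l2norm_add_le (R • (z - (A.mulVec y + R⁻¹ • e))) (A.mulVec (R • y - c k))
      rw [← h, l2norm_smul, abs_of_pos hRpos] at h₁
      have h₂ := hA (R • y - c k)
      have h₃ := mul_le_mul_of_nonneg_left hd hRpos.le
      nlinarith

lemma computes_iterStep {n m' : ℕ} (m : ℕ) (b : Fin n → ℝ) {F : (StateIdx n → ℝ) → Fin m' → ℝ}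
    {d s : ℕ} (hF : Computes F d s) :
    Computes (F ∘ iterStep n m b) (d + (m + 2)) (s + 72 * (n * n) * (m + 1)) := by
  have h := ((hF.comp (sparseLayer_collectStep n (4 / 4 ^ m) b)).iterate
    (fun _ _ _ h => h.comp (sparseLayer_foldStep n)) m).comp (sparseLayer_prepareStep n)
  obtain ⟨k, e, Φ, hΦ, hd, hs⟩ := h
  refine ⟨k, e, Φ, hΦ, by omega, hs.trans ?_⟩
  nlinarith

/-- The initial state of the network. -/
noncomputable def initStep (n : ℕ) (b : Fin n → ℝ) (x : Fin (n * n) → ℝ) (t : StateIdx n) : ℝ :=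
  (![1, 0, 0, 0] : Fin 4 → ℝ) t.2 * x (finProdFinEquiv t.1) +
    (![0, 0, 0, 1] : Fin 4 → ℝ) t.2 * b t.1.1

lemma sparseAffine_initStep (n : ℕ) (b : Fin n → ℝ) :
    SparseAffine (initStep n b) (8 * (n * n)) := by
  have h := (SparseAffine.gather (fun t : StateIdx n => finProdFinEquiv t.1)
    fun t => (![1, 0, 0, 0] : Fin 4 → ℝ) t.2).add
    (SparseAffine.const fun t : StateIdx n => (![0, 0, 0, 1] : Fin 4 → ℝ) t.2 * b t.1.1)
  refine h.mono (le_of_eq ?_)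
  simp only [Fintype.card_prod, Fintype.card_fin]
  ring

/-- A network running `K` approximate iteration steps. -/
lemma exists_iteration_network (n m K : ℕ) (R : ℝ) (b : Fin n → ℝ) :
    ∃ Φ : NN (n * n) n,
      (∀ x, Φ.realize x = R • fun i => (iterStep n m b)^[K] (initStep n b x) ((i, i), 3)) ∧
        Φ.depth = K * (m + 2) + 2 ∧
          Φ.size ≤ K * (72 * (n * n) * (m + 1)) + 18 * (n * n) := by
  have h₀ : SparseLayer (fun (v : StateIdx n → ℝ) i => R * v ((i, i), 3)) (2 * n) := by
    have h := SparseLayer.gather (fun i : Fin n => (((i, i), 3) : StateIdx n)) fun _ => R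
    refine h.mono (le_of_eq ?_)
    rw [Fintype.card_fin, two_mul]
  obtain ⟨Φ, hΦ, hd, hs⟩ := ((Computes.of_sparseLayer h₀).iterate
    (fun _ _ _ h => computes_iterStep m b h) K).exists_network (sparseAffine_initStep n b)
  refine ⟨Φ, hΦ, by omega, hs.trans ?_⟩
  nlinarith [Nat.le_mul_self n]

lemma exists_fold_count {Q : ℝ} (hQ : 0 < Q) :
    ∃ D : ℝ, 0 ≤ D ∧ ∀ ε : ℝ, 0 < ε → ∀ N : ℕ, 1 ≤ N → ∃ m : ℕ,
      Q * ((N + 1 : ℕ) * ((N + 1 : ℕ) * (1 / 4 ^ m))) ≤ ε ∧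
        (m : ℝ) ≤ D * (|Real.log ε| + Real.log N + 1) := by
  refine ⟨|Real.log Q| + 3, by positivity, fun ε hε N hN => ?_⟩
  have hN' : (1 : ℝ) ≤ N := by exact_mod_cast hN
  have hlN : 0 ≤ Real.log N := Real.log_nonneg hN'
  have hl : Real.log (Q * (N + 1) ^ 2 / ε) ≤ |Real.log Q| + 2 * (1 + Real.log N) + |Real.log ε| := by
    have h₁ : Real.log ((N : ℝ) + 1) ≤ 1 + Real.log N := by
      calc Real.log ((N : ℝ) + 1) ≤ Real.log (2 * N) := Real.log_le_log (by positivity) (by linarith)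
        _ = Real.log 2 + Real.log N := Real.log_mul (by norm_num) (by positivity)
        _ ≤ 1 + Real.log N := by linarith [Real.log_two_lt_d9]
    rw [Real.log_div (by positivity) hε.ne', Real.log_mul hQ.ne' (by positivity), Real.log_pow]
    have h₂ := le_abs_self (Real.log Q)
    have h₃ := neg_abs_le (Real.log ε)
    push_cast
    linarith
  refine ⟨⌈|Real.log Q| + 2 * (1 + Real.log N) + |Real.log ε|⌉₊, ?_, ?_⟩
  · set m := ⌈|Real.log Q| + 2 * (1 + Real.log N) + |Real.log ε|⌉₊
    have h : Q * (N + 1) ^ 2 / ε ≤ 4 ^ m := by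
      calc Q * (N + 1) ^ 2 / ε = Real.exp (Real.log (Q * (N + 1) ^ 2 / ε)) :=
            (Real.exp_log (by positivity)).symm
        _ ≤ Real.exp m := Real.exp_le_exp.2 (hl.trans (Nat.le_ceil _))
        _ = Real.exp 1 ^ m := by rw [← Real.exp_nat_mul, mul_one]
        _ ≤ 4 ^ m := pow_le_pow_left₀ (Real.exp_pos 1).le
            (by linarith [Real.exp_one_lt_d9]) m
    rw [div_le_iff₀ hε] at h
    push_cast
    calc Q * ((N + 1) * ((N + 1) * (1 / 4 ^ m))) = Q * (N + 1) ^ 2 / 4 ^ m := by ring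
      _ ≤ ε := (div_le_iff₀ (by positivity)).2 (by linarith)
  · have h := (Nat.ceil_lt_add_one (a := |Real.log Q| + 2 * (1 + Real.log N) + |Real.log ε|)
      (by positivity)).le
    nlinarith [mul_nonneg (abs_nonneg (Real.log Q)) hlN,
      mul_nonneg (abs_nonneg (Real.log Q)) (abs_nonneg (Real.log ε)), abs_nonneg (Real.log ε)]

/-- Lemma 5.3 (unrolled Richardson iterator network): a ReLU NN mapping
`vec(A)` to an `ε`-accurate approximation of the `K`-th iterate `c⁽ᴷ⁾`,
uniformly over matrices with spectral norm `≤ β/α`, with the stated depth and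
size bounds. -/
theorem stmt8 (α β : ℝ) (hβ : 0 < β) (hβα : β < α) :
    ∃ C : ℝ, 0 < C ∧
      ∀ ε : ℝ, 0 < ε → ε < 1 → ∀ K N : ℕ, 1 ≤ K → 1 ≤ N →
        ∃ Φ : NN ((N + 1) * (N + 1)) (N + 1),
          (∀ A : Matrix (Fin (N + 1)) (Fin (N + 1)) ℝ,
            (∀ x, l2norm (A.mulVec x) ≤ β / α * l2norm x) →
              l2norm (Φ.realize (vecMat A) - iterC A K) ≤ ε) ∧
          (Φ.depth : ℝ) ≤ C * K * (|Real.log ε| + Real.log N + 1) ∧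
          (Φ.size : ℝ) ≤ C * K * (N : ℝ) ^ 2 * (|Real.log ε| + Real.log N + 1) := by
  have hα : 0 < α := hβ.trans hβα
  set δ := β / α
  have hδ₀ : 0 ≤ δ := by positivity
  have hδ₁ : δ < 1 := (div_lt_one hα).2 hβα
  have hδ' : 0 < 1 - δ := by linarith
  obtain ⟨D, hD, hcount⟩ := exists_fold_count (Q := 2 / (1 - δ) / (1 - δ)) (by positivity)
  refine ⟨288 * D + 360, by positivity, fun ε hε₀ hε₁ K N hK hN => ?_⟩
  obtain ⟨m, hm, hmD⟩ := hcount ε hε₀ N hN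
  set e : Fin (N + 1) → ℝ := fun i => if (i : ℕ) = 0 then 1 else 0
  have he' : e = Pi.single 0 1 := by
    funext i
    change (if (i : ℕ) = 0 then (1 : ℝ) else 0) = _
    simp only [Pi.single_apply, Fin.ext_iff, Fin.val_zero]
  obtain ⟨Φ, hΦ, hd, hs⟩ :=
    exists_iteration_network (N + 1) m K (2 / (1 - δ)) ((2 / (1 - δ))⁻¹ • e)
  have hL : 1 ≤ |Real.log ε| + Real.log N + 1 := by
    have := Real.log_nonneg (show (1 : ℝ) ≤ N by exact_mod_cast hN)
    have := abs_nonneg (Real.log ε)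
    linarith
  set L := |Real.log ε| + Real.log N + 1
  have hK' : (1 : ℝ) ≤ K := by exact_mod_cast hK
  have hN' : (1 : ℝ) ≤ N := by exact_mod_cast hN
  have hDL : 0 ≤ D * L := by positivity
  refine ⟨Φ, fun A hA => ?_, ?_, ?_⟩
  · rw [hΦ]
    refine (iterStep_iterate hδ₀ hδ₁ hε₀ hε₁.le (div_mul_cancel₀ _ hδ'.ne') ?_ hA
      (by rw [he', l2norm_single]) (e := e) (c := iterC A) rfl (fun _ => rfl) ?_ ?_ K).2.2
    · calc _ = 2 / (1 - δ) / (1 - δ) * ((N + 1 : ℕ) * ((N + 1 : ℕ) * (1 / 4 ^ m))) * (1 - δ) := by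
            field_simp
        _ ≤ ε * (1 - δ) := mul_le_mul_of_nonneg_right hm hδ'.le
    · intro i j
      simp [initStep, vecMat]
    · intro j
      simp [initStep]
  · rw [hd]
    push_cast
    calc (K : ℝ) * (m + 2) + 2 ≤ K * (m + 2) + 2 * K := by linarith
      _ = K * (m + 4) := by ring
      _ ≤ K * ((288 * D + 360) * L) := mul_le_mul_of_nonneg_left (by linarith) (by positivity)
      _ = (288 * D + 360) * K * L := by ring
  · have hs' : (Φ.size : ℝ) ≤ K * (72 * ((N + 1) * (N + 1)) * (m + 1)) + 18 * ((N + 1) * (N + 1)) := by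
      exact_mod_cast hs
    have hn : ((N : ℝ) + 1) * (N + 1) ≤ 4 * N ^ 2 := by nlinarith
    calc (Φ.size : ℝ)
        ≤ K * (72 * ((N + 1) * (N + 1)) * (m + 1)) + 18 * ((N + 1) * (N + 1)) := hs'
      _ ≤ K * (72 * ((N + 1) * (N + 1)) * (m + 1)) + K * (18 * ((N + 1) * (N + 1))) :=
          add_le_add_right (le_mul_of_one_le_left (by positivity) hK') _
      _ = K * (((N + 1) * (N + 1)) * (72 * m + 90)) := by ring
      _ ≤ K * ((4 * N ^ 2) * ((72 * D + 90) * L)) :=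
          mul_le_mul_of_nonneg_left
            (mul_le_mul hn (by linarith) (by positivity) (by positivity)) (by positivity)
      _ = (288 * D + 360) * K * N ^ 2 * L := by ring
end

section
/- (Lemma 6.5, encoder for analytic data) Let d ∈ {2,3}, let Ω ⊂ ℝ^d be a bounded open set whose closure admits a regular simplicial triangulation, and let B > 0. Then there exists C > 0 such that for every ε ∈ (0,1) there exist M ∈ ℕ with M ≤ C(1 + |log ε|^d), a map E : A(Ω̄; B) → ℝ^M, and functions ξ₁, …, ξ_M ∈ L^∞(Ω) such that sup_{a ∈ A(Ω̄;B)} ‖a − Σ_{k=1}^M (E(a))_k ξ_k‖_{L^∞(Ω)} ≤ ε. -/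
/-- Iterated partial derivative `∂^ν v` of `v : ℝ^d → ℝ`, encoded by a list of
coordinate directions. -/
noncomputable def partialDeriv {d : ℕ} (v : EuclideanSpace ℝ (Fin d) → ℝ) :
    List (Fin d) → EuclideanSpace ℝ (Fin d) → ℝ
  | [] => v
  | i :: l => fun x => fderiv ℝ (partialDeriv v l) x (EuclideanSpace.single i 1)

/-- The class `A(Ω̄; B)` of functions analytic near `Ω̄` with
`|∂^ν v| ≤ B^{|ν|+1} |ν|!` on `Ω` for all multi-indices `ν`. -/
def AnalClass {d : ℕ} (Ω : Set (EuclideanSpace ℝ (Fin d))) (B : ℝ) :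
    Set (EuclideanSpace ℝ (Fin d) → ℝ) :=
  {v | (∃ U, IsOpen U ∧ closure Ω ⊆ U ∧ ContDiffOn ℝ (⊤ : ℕ∞) v U) ∧
    ∀ l : List (Fin d), ∀ x ∈ Ω,
      |partialDeriv v l x| ≤ B ^ (l.length + 1) * (Nat.factorial l.length : ℝ)}

/-- `Ω̄` is the union of finitely many nondegenerate closed `d`-simplices, any
two of which intersect in the convex hull of a common set of vertices (a regular
simplicial triangulation of `Ω̄`). -/
def HasRegularTriangulation {d : ℕ} (Ω : Set (EuclideanSpace ℝ (Fin d))) : Prop :=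
  ∃ (n : ℕ) (v : Fin n → Fin (d + 1) → EuclideanSpace ℝ (Fin d)),
    (∀ i, AffineIndependent ℝ (v i)) ∧
    closure Ω = ⋃ i, convexHull ℝ (Set.range (v i)) ∧
    ∀ i j, ∃ s : Set (EuclideanSpace ℝ (Fin d)),
      s ⊆ Set.range (v i) ∧ s ⊆ Set.range (v j) ∧
      convexHull ℝ (Set.range (v i)) ∩ convexHull ℝ (Set.range (v j)) =
        convexHull ℝ s

theorem contDiffOn_partialDeriv {d : ℕ} {v : EuclideanSpace ℝ (Fin d) → ℝ}
    {U : Set (EuclideanSpace ℝ (Fin d))} (hU : IsOpen U) (hv : ContDiffOn ℝ (⊤ : ℕ∞) v U)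
    (l : List (Fin d)) : ContDiffOn ℝ (⊤ : ℕ∞) (partialDeriv v l) U := by
  induction l with
  | nil => exact hv
  | cons i l ih =>
    exact (ih.fderiv_of_isOpen hU (by simp)).clm_apply contDiffOn_const

theorem abs_partialDeriv_le_of_mem_closure {d : ℕ} {Ω : Set (EuclideanSpace ℝ (Fin d))} {B : ℝ}
    {v : EuclideanSpace ℝ (Fin d) → ℝ} (hv : v ∈ AnalClass Ω B) (l : List (Fin d))
    {x : EuclideanSpace ℝ (Fin d)} (hx : x ∈ closure Ω) :
    |partialDeriv v l x| ≤ B ^ (l.length + 1) * (Nat.factorial l.length : ℝ) := by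
  obtain ⟨⟨U, hU, hΩU, hvU⟩, hb⟩ := hv
  have hc : ContinuousOn (fun x => |partialDeriv v l x|) (closure Ω) :=
    ((contDiffOn_partialDeriv hU hvU l).continuousOn.mono hΩU).abs
  exact le_on_closure (hb l) hc continuousOn_const hx

/-- The `m`-th derivative of `v` at `y` evaluated at `(h, …, h)`, expanded in coordinates. -/
noncomputable def dirDeriv {d : ℕ} (v : EuclideanSpace ℝ (Fin d) → ℝ)
    (h : EuclideanSpace ℝ (Fin d)) (m : ℕ) (y : EuclideanSpace ℝ (Fin d)) : ℝ :=
  ∑ f : Fin m → Fin d, partialDeriv v (List.ofFn f) y * ∏ j, h (f j)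

theorem clm_apply_eq_sum_single {d : ℕ} (L : EuclideanSpace ℝ (Fin d) →L[ℝ] ℝ)
    (h : EuclideanSpace ℝ (Fin d)) :
    L h = ∑ i, L (EuclideanSpace.single i 1) * h i := by
  conv_lhs => rw [← (EuclideanSpace.basisFun (Fin d) ℝ).sum_repr h]
  simp [mul_comm]

theorem hasDerivAt_dirDeriv {d : ℕ} {v : EuclideanSpace ℝ (Fin d) → ℝ}
    {U : Set (EuclideanSpace ℝ (Fin d))} (hU : IsOpen U) (hv : ContDiffOn ℝ (⊤ : ℕ∞) v U)
    (c h : EuclideanSpace ℝ (Fin d)) (m : ℕ) {t : ℝ} (ht : c + t • h ∈ U) :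
    HasDerivAt (fun s : ℝ => dirDeriv v h m (c + s • h)) (dirDeriv v h (m + 1) (c + t • h)) t := by
  have hline : HasDerivAt (fun s : ℝ => c + s • h) h t := by
    simpa using ((hasDerivAt_id t).smul_const h).const_add c
  have key : ∀ l : List (Fin d), HasDerivAt (fun s : ℝ => partialDeriv v l (c + s • h))
      (∑ i, partialDeriv v (i :: l) (c + t • h) * h i) t := by
    intro l
    have hd : DifferentiableAt ℝ (partialDeriv v l) (c + t • h) :=
      ((contDiffOn_partialDeriv hU hv l).contDiffAt (hU.mem_nhds ht)).differentiableAt (by simp)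
    have := hd.hasFDerivAt.comp_hasDerivAt t hline
    rwa [clm_apply_eq_sum_single] at this
  have hsum := HasDerivAt.fun_sum (u := Finset.univ) fun (f : Fin m → Fin d) _ =>
    (key (List.ofFn f)).mul_const (∏ j, h (f j))
  refine hsum.congr_deriv (Eq.symm ?_)
  unfold dirDeriv
  rw [← (Fin.consEquiv fun _ => Fin d).sum_comp, Fintype.sum_prod_type, Finset.sum_comm]
  refine Finset.sum_congr rfl fun f _ => ?_
  rw [Finset.sum_mul]
  refine Finset.sum_congr rfl fun i _ => ?_
  simp [Fin.consEquiv, List.ofFn_succ, Fin.prod_univ_succ, mul_assoc]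

theorem abs_dirDeriv_le {d : ℕ} {Ω : Set (EuclideanSpace ℝ (Fin d))} {B δ : ℝ} (hB : 0 < B)
    {v : EuclideanSpace ℝ (Fin d) → ℝ} (hv : v ∈ AnalClass Ω B)
    {h : EuclideanSpace ℝ (Fin d)} (hh : ‖h‖ ≤ δ) (m : ℕ) {y : EuclideanSpace ℝ (Fin d)}
    (hy : y ∈ closure Ω) :
    |dirDeriv v h m y| ≤ B * (d * B * δ) ^ m * (Nat.factorial m : ℝ) := by
  calc |dirDeriv v h m y|
      ≤ ∑ f : Fin m → Fin d, |partialDeriv v (List.ofFn f) y * ∏ j, h (f j)| :=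
        Finset.abs_sum_le_sum_abs _ _
    _ ≤ ∑ _f : Fin m → Fin d, B ^ (m + 1) * (Nat.factorial m : ℝ) * δ ^ m := by
        refine Finset.sum_le_sum fun f _ => ?_
        rw [abs_mul, Finset.abs_prod]
        refine mul_le_mul ?_ ?_ (by positivity) (by positivity)
        · simpa using abs_partialDeriv_le_of_mem_closure hv (List.ofFn f) hy
        · calc ∏ j, |h (f j)| ≤ ∏ _j : Fin m, δ :=
                Finset.prod_le_prod (fun _ _ => abs_nonneg _)
                  fun j _ => (PiLp.norm_apply_le h (f j)).trans hh
            _ = δ ^ m := by simp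
    _ = _ := by
        simp only [Finset.sum_const, Finset.card_univ, Fintype.card_fun, Fintype.card_fin,
          nsmul_eq_mul, Nat.cast_pow]
        ring

theorem abs_sub_sum_dirDeriv_le {d : ℕ} {Ω : Set (EuclideanSpace ℝ (Fin d))} {B δ : ℝ}
    (hB : 0 < B) (hδ : d * B * δ = 1 / 4) {v : EuclideanSpace ℝ (Fin d) → ℝ}
    (hv : v ∈ AnalClass Ω B) {c x : EuclideanSpace ℝ (Fin d)} (hcx : ‖x - c‖ ≤ δ)
    (hseg : segment ℝ c x ⊆ closure Ω) (n : ℕ) :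
    |v x - ∑ m ∈ Finset.range (n + 1), dirDeriv v (x - c) m c / (Nat.factorial m : ℝ)| ≤
      B * (1 / 2) ^ (n + 1) := by
  obtain ⟨U, hU, hΩU, hvU⟩ := hv.1
  set h := x - c with hh
  have hmem : ∀ t ∈ Set.Icc (0 : ℝ) 1, c + t • h ∈ closure Ω := fun t ht =>
    hseg (by rw [segment_eq_image']; exact ⟨t, ht, rfl⟩)
  have hder : ∀ m, ∀ t ∈ Set.Icc (0 : ℝ) 1,
      iteratedDerivWithin m (fun s : ℝ => v (c + s • h)) (Set.Icc 0 1) t =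
        dirDeriv v h m (c + t • h) := by
    intro m
    induction m with
    | zero => intro t _; simp [dirDeriv, partialDeriv]
    | succ m ih =>
      intro t ht
      rw [iteratedDerivWithin_succ, derivWithin_congr ih (ih t ht)]
      exact (hasDerivAt_dirDeriv hU hvU c h m (hΩU (hmem t ht))).hasDerivWithinAt.derivWithin
        (uniqueDiffOn_Icc_zero_one t ht)
  have hcd : ContDiffOn ℝ (n + 1) (fun s : ℝ => v (c + s • h)) (Set.Icc 0 1) := by
    have h1 : ContDiffOn ℝ (n + 1) v U := hvU.of_le (by exact_mod_cast le_top)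
    exact h1.comp (by fun_prop : ContDiff ℝ (n + 1) fun s : ℝ => c + s • h).contDiffOn
      fun t ht => hΩU (hmem t ht)
  have hT := taylor_mean_remainder_bound (zero_le_one' ℝ) hcd (Set.right_mem_Icc.2 zero_le_one)
    (C := B * (1 / 4) ^ (n + 1) * (Nat.factorial (n + 1) : ℝ)) (fun t ht => by
      rw [hder _ t ht, Real.norm_eq_abs, ← hδ]
      exact abs_dirDeriv_le hB hv hcx (n + 1) (hmem t ht))
  rw [taylor_within_apply, Real.norm_eq_abs] at hT
  have e1 : c + (1 : ℝ) • h = x := by simp [hh]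
  have e2 : ∑ m ∈ Finset.range (n + 1), dirDeriv v h m c / (Nat.factorial m : ℝ) =
      ∑ k ∈ Finset.range (n + 1), ((Nat.factorial k : ℝ)⁻¹ * (1 - 0) ^ k) •
        iteratedDerivWithin k (fun s : ℝ => v (c + s • h)) (Set.Icc 0 1) 0 := by
    refine Finset.sum_congr rfl fun k _ => ?_
    rw [hder k 0 (by simp)]
    simp [div_eq_inv_mul]
  rw [← e2, e1] at hT
  refine hT.trans ?_
  have hf : (0 : ℝ) < Nat.factorial n := by positivity
  have h2 : ((n : ℝ) + 1) ≤ 2 ^ (n + 1) := by exact_mod_cast (Nat.lt_two_pow_self (n := n + 1)).le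
  rw [Nat.factorial_succ, div_le_iff₀ hf]
  push_cast
  have e3 : (1 / 4 : ℝ) ^ (n + 1) = (1 / 2) ^ (n + 1) * (1 / 2) ^ (n + 1) := by
    rw [← mul_pow]; norm_num
  have h3 : (1 / 2 : ℝ) ^ (n + 1) * (n + 1) ≤ 1 := by
    rw [one_div, inv_pow]; exact inv_mul_le_one_of_le₀ h2 (by positivity)
  calc _ = B * (1 / 2) ^ (n + 1) * Nat.factorial n * ((1 / 2 : ℝ) ^ (n + 1) * (n + 1)) := by
        rw [e3]; ring
    _ ≤ B * (1 / 2) ^ (n + 1) * Nat.factorial n * 1 := by gcongr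
    _ = _ := by ring

/-- The multi-index of a word in the coordinates, with entries bounded by its length. -/
def wordIndex {d N : ℕ} {m : Fin N} (f : Fin m → Fin d) : Fin d → Fin N := fun i =>
  ⟨(Finset.univ.filter fun j => f j = i).card,
    lt_of_le_of_lt ((Finset.card_le_univ _).trans_eq (Fintype.card_fin _)) m.2⟩

/-- The Taylor coefficient of `v` at `c` with multi-index `ν`, truncated at order `N`. -/
noncomputable def taylorCoeff {d N : ℕ} (v : EuclideanSpace ℝ (Fin d) → ℝ)
    (c : EuclideanSpace ℝ (Fin d)) (ν : Fin d → Fin N) : ℝ :=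
  ∑ m : Fin N, ∑ f : Fin m → Fin d,
    if wordIndex f = ν then partialDeriv v (List.ofFn f) c / (Nat.factorial m : ℝ) else 0

theorem sum_taylorCoeff_mul {d : ℕ} (N : ℕ) (v : EuclideanSpace ℝ (Fin d) → ℝ)
    (c h : EuclideanSpace ℝ (Fin d)) :
    ∑ ν : Fin d → Fin N, taylorCoeff v c ν * ∏ i, h i ^ (ν i : ℕ) =
      ∑ m ∈ Finset.range N, dirDeriv v h m c / (Nat.factorial m : ℝ) := by
  rw [Finset.sum_range]
  simp only [taylorCoeff, Finset.sum_mul, dirDeriv, Finset.sum_div]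
  rw [Finset.sum_comm]
  refine Finset.sum_congr rfl fun m _ => ?_
  rw [Finset.sum_comm]
  refine Finset.sum_congr rfl fun f _ => ?_
  simp only [ite_mul, zero_mul, Finset.sum_ite_eq, Finset.mem_univ, if_true]
  have : ∏ i, h i ^ (wordIndex f i : ℕ) = ∏ j, h (f j) := by
    rw [← Finset.prod_fiberwise' Finset.univ f fun i => h i]
    simp [wordIndex]
  rw [this]
  ring

theorem HasRegularTriangulation.exists_finset_centers {d : ℕ}
    {Ω : Set (EuclideanSpace ℝ (Fin d))} (hΩ : HasRegularTriangulation Ω) {δ : ℝ} (hδ : 0 < δ) :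
    ∃ S : Finset (EuclideanSpace ℝ (Fin d)), ∀ x ∈ closure Ω, ∃ c ∈ S,
      ‖x - c‖ ≤ δ ∧ segment ℝ c x ⊆ closure Ω := by
  classical
  obtain ⟨n, v, -, hcl, -⟩ := hΩ
  have hcover : ∀ i, ∃ t ⊆ convexHull ℝ (Set.range (v i)), t.Finite ∧
      convexHull ℝ (Set.range (v i)) ⊆ ⋃ c ∈ t, Metric.ball c δ := fun i =>
    Metric.finite_approx_of_totallyBounded
      ((Set.finite_range (v i)).isCompact_convexHull (𝕜 := ℝ)).totallyBounded δ hδ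
  choose t hts htf htc using hcover
  refine ⟨Finset.univ.biUnion fun i => (htf i).toFinset, fun x hx => ?_⟩
  rw [hcl] at hx
  obtain ⟨i, hi⟩ := Set.mem_iUnion.1 hx
  obtain ⟨c, hc, hxc⟩ := Set.mem_iUnion₂.1 (htc i hi)
  refine ⟨c, by simpa using ⟨i, hc⟩, ?_, ?_⟩
  · rw [← dist_eq_norm]; exact (Metric.mem_ball.1 hxc).le
  · rw [hcl]
    exact ((convex_convexHull ℝ _).segment_subset (hts i hc) hi).trans
      (Set.subset_iUnion (fun i => convexHull ℝ (Set.range (v i))) i)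

theorem exists_order_of_accuracy {B : ℝ} (hB : 0 < B) :
    ∃ K : ℝ, 0 < K ∧ ∀ ε : ℝ, 0 < ε → ∃ n : ℕ,
      B * (1 / 2) ^ (n + 1) ≤ ε ∧ ((n + 1 : ℕ) : ℝ) ≤ K * (1 + |Real.log ε|) := by
  refine ⟨2 * |Real.log B| + 2, by positivity, fun ε hε => ?_⟩
  have hA := abs_nonneg (Real.log B)
  have hL := abs_nonneg (Real.log ε)
  refine ⟨⌈2 * (|Real.log B| + |Real.log ε|)⌉₊, ?_, ?_⟩
  · have h1 := Nat.le_ceil (2 * (|Real.log B| + |Real.log ε|))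
    set n := ⌈2 * (|Real.log B| + |Real.log ε|)⌉₊
    rw [← Real.log_le_log_iff (by positivity) hε, Real.log_mul hB.ne' (by positivity),
      Real.log_pow, one_div, Real.log_inv]
    push_cast
    have h2 := Real.log_two_gt_d9
    have h3 := le_abs_self (Real.log B)
    have h4 := neg_abs_le (Real.log ε)
    nlinarith
  · have h1 := (Nat.ceil_lt_add_one (by positivity : 0 ≤ 2 * (|Real.log B| + |Real.log ε|))).le
    push_cast
    nlinarith [mul_nonneg hA hL]

/-- Lemma 6.5 (encoder for analytic data): a linear-in-the-data encoding of the
analytic class `A(Ω̄; B)` into `M = O(|log ε|^d)` coefficients with bounded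
reconstruction functions `ξ_k ∈ L^∞(Ω)`, accurate to `ε` in `L^∞(Ω)`. -/
theorem stmt16 (d : ℕ) (hd : d = 2 ∨ d = 3)
    (Ω : Set (EuclideanSpace ℝ (Fin d))) (hΩo : IsOpen Ω)
    (hΩb : Bornology.IsBounded Ω) (hΩt : HasRegularTriangulation Ω)
    (B : ℝ) (hB : 0 < B) :
    ∃ C : ℝ, 0 < C ∧
      ∀ ε : ℝ, 0 < ε → ε < 1 →
        ∃ (M : ℕ) (Enc : (EuclideanSpace ℝ (Fin d) → ℝ) → Fin M → ℝ)
          (ξ : Fin M → EuclideanSpace ℝ (Fin d) → ℝ),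
          (M : ℝ) ≤ C * (1 + |Real.log ε| ^ d) ∧
          (∀ k, ∃ Ck : ℝ, ∀ x ∈ Ω, |ξ k x| ≤ Ck) ∧
          ∀ a ∈ AnalClass Ω B, ∀ x ∈ Ω,
            |a x - ∑ k, Enc a k * ξ k x| ≤ ε := by
  classical
  have hd0 : (0 : ℝ) < d := by rcases hd with rfl | rfl <;> norm_num
  set δ : ℝ := 1 / (4 * (d * B)) with hδ_def
  have hδ0 : 0 < δ := by positivity
  have hδ : d * B * δ = 1 / 4 := by rw [hδ_def]; field_simp
  obtain ⟨S, hS⟩ := hΩt.exists_finset_centers hδ0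
  obtain ⟨K, hK0, hK⟩ := exists_order_of_accuracy hB
  choose! p hpS hpδ hpseg using hS
  refine ⟨(S.card + 1) * (K ^ d * 2 ^ (d - 1)), by positivity, fun ε hε _ => ?_⟩
  obtain ⟨n, hnε, hnK⟩ := hK ε hε
  let e := Fintype.equivFin (S × (Fin d → Fin (n + 1)))
  refine ⟨Fintype.card (S × (Fin d → Fin (n + 1))),
    fun a k => taylorCoeff a (e.symm k).1 (e.symm k).2,
    fun k x => if p x = (e.symm k).1 then
      ∏ i, (x - (e.symm k).1.1) i ^ ((e.symm k).2 i : ℕ) else 0, ?_, ?_, ?_⟩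
  · have hL := abs_nonneg (Real.log ε)
    have h1 : ((n + 1 : ℕ) : ℝ) ^ d ≤ K ^ d * (2 ^ (d - 1) * (1 + |Real.log ε| ^ d)) := by
      calc ((n + 1 : ℕ) : ℝ) ^ d ≤ (K * (1 + |Real.log ε|)) ^ d := by gcongr
        _ = K ^ d * (1 + |Real.log ε|) ^ d := mul_pow _ _ _
        _ ≤ _ := by
          gcongr
          simpa using add_pow_le zero_le_one hL d
    simp only [Fintype.card_prod, Fintype.card_coe, Fintype.card_fun, Fintype.card_fin,
      Nat.cast_mul, Nat.cast_pow]
    calc (S.card : ℝ) * ((n + 1 : ℕ) : ℝ) ^ d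
        ≤ (S.card + 1) * (K ^ d * (2 ^ (d - 1) * (1 + |Real.log ε| ^ d))) := by
          gcongr
          linarith
      _ = _ := by ring
  · intro k
    refine ⟨∏ i, δ ^ ((e.symm k).2 i : ℕ), fun x hx => ?_⟩
    beta_reduce
    split_ifs with hpx
    · rw [Finset.abs_prod]
      refine Finset.prod_le_prod (fun _ _ => abs_nonneg _) fun i _ => ?_
      rw [abs_pow]
      gcongr
      rw [← hpx]
      exact (PiLp.norm_apply_le (x - p x) i).trans (hpδ x (subset_closure hx))
    · simp only [abs_zero]
      positivity
  · intro a ha x hx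
    have hx' := subset_closure hx
    refine le_trans (le_of_eq ?_)
      ((abs_sub_sum_dirDeriv_le hB hδ ha (hpδ x hx') (hpseg x hx') n).trans hnε)
    congr 2
    rw [← sum_taylorCoeff_mul,
      e.symm.sum_comp fun q : S × (Fin d → Fin (n + 1)) => taylorCoeff a q.1 q.2 *
        if p x = q.1 then ∏ i, (x - q.1.1) i ^ (q.2 i : ℕ) else 0,
      Fintype.sum_prod_type, Finset.sum_eq_single ⟨p x, hpS x hx'⟩]
    · simp
    · intro c _ hc
      have : p x ≠ c := fun h => hc (Subtype.ext h.symm)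
      simp [this]
    · simp
end
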